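/- For every associative unital ℂ-algebra A, one has M_3(A)·M_3(A) ⊆ M_5(A); that is, the pair (3,3) is null. -/

import Mathlib

noncomputable section

/-- `lcs k A n` is the `(n+1)`-st term `L_{n+1}(A)` of the lower central series of `A`
regarded as a Lie algebra under the commutator `[a,b] = a*b - b*a`:
`lcs k A 0 = L_1(A) = A` and `L_{n+2}(A) = span [A, L_{n+1}(A)]`. -/
def lcs (k A : Type*) [Field k] [Ring A] [Algebra k A] : ℕ → Submodule k A
  | 0 => ⊤
  | n + 1 => Submodule.span k {x | ∃ a : A, ∃ b ∈ lcs k A n, x = a * b - b * a}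

/-- `Lser k A i = L_i(A)` for `i ≥ 1`. -/
def Lser (k A : Type*) [Field k] [Ring A] [Algebra k A] (i : ℕ) : Submodule k A :=
  lcs k A (i - 1)

/-- The two-sided ideal of `A` generated by a set `S`, as a `k`-submodule. -/
def idealGen (k : Type*) {A : Type*} [Field k] [Ring A] [Algebra k A] (S : Set A) :
    Submodule k A :=
  Submodule.span k {x | ∃ a b : A, ∃ s ∈ S, x = a * s * b}

/-- `Mser k A i = M_i(A)`, the two-sided ideal of `A` generated by `L_i(A)`. -/
def Mser (k A : Type*) [Field k] [Ring A] [Algebra k A] (i : ℕ) : Submodule k A :=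
  idealGen k (Lser k A i : Set A)

/-- Three times the commutator of `a * ⁅b, ⁅c, d⁆⁆` with `e` as an integral combination of
fourfold commutators. -/
theorem three_nsmul_mul_lie_lie_lie {A : Type*} [Ring A] (a b c d e : A) :
    3 • ⁅a * ⁅b, ⁅c, d⁆⁆, e⁆ =
      ⁅e, ⁅b * c, ⁅a, d⁆⁆⁆ + ⁅a * d, ⁅c, ⁅b, e⁆⁆⁆ + ⁅e * b, ⁅a, ⁅c, d⁆⁆⁆ + ⁅d * e, ⁅b, ⁅a, c⁆⁆⁆
        + ⁅d, ⁅c * b, ⁅a, e⁆⁆⁆ + ⁅e, ⁅a, ⁅b, d * c⁆⁆⁆ + 2 • ⁅e * a, ⁅d, ⁅b, c⁆⁆⁆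
        + ⁅c * d, ⁅b, ⁅a, e⁆⁆⁆ + ⁅c * d, ⁅a, ⁅b, e⁆⁆⁆ + ⁅a, ⁅c * e, ⁅b, d⁆⁆⁆
        + ⁅d * a, ⁅c, ⁅b, e⁆⁆⁆ - 3 • ⁅a, ⁅e, ⁅b, c * d⁆⁆⁆ - ⁅d * b, ⁅e, ⁅a, c⁆⁆⁆
        - 2 • ⁅a, ⁅d * b, ⁅c, e⁆⁆⁆ - ⁅c * e, ⁅d, ⁅a, b⁆⁆⁆ - ⁅c, ⁅e, ⁅a * b, d⁆⁆⁆
        - ⁅a, ⁅c, ⁅b, d * e⁆⁆⁆ - ⁅e, ⁅b * a, ⁅c, d⁆⁆⁆ - ⁅d, ⁅a * e, ⁅b, c⁆⁆⁆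
        - ⁅b, ⁅e, ⁅c * a, d⁆⁆⁆ - ⁅b, ⁅c * a, ⁅d, e⁆⁆⁆ - ⁅b, ⁅c * d, ⁅a, e⁆⁆⁆
        - ⁅a, ⁅d, ⁅b * e, c⁆⁆⁆ - ⁅d, ⁅a * c, ⁅b, e⁆⁆⁆ - ⁅e * a, ⁅c, ⁅b, d⁆⁆⁆ := by
  simp only [Ring.lie_def]
  noncomm_ring

section LowerCentralSeries

variable (k : Type*) {A : Type*} [Field k] [Ring A] [Algebra k A]

theorem lie_mem_lcs_succ {n : ℕ} (a : A) {b : A} (hb : b ∈ lcs k A n) :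
    ⁅a, b⁆ ∈ lcs k A (n + 1) :=
  Submodule.subset_span ⟨a, b, hb, Ring.lie_def a b⟩

theorem lcs_succ_le (n : ℕ) : lcs k A (n + 1) ≤ lcs k A n := by
  induction n with
  | zero => exact le_top
  | succ n ih =>
    refine Submodule.span_le.2 ?_
    rintro _ ⟨a, b, hb, rfl⟩
    exact lie_mem_lcs_succ k a (ih hb)

theorem lcs_succ_le_of_lie_mem {n : ℕ} {P : Submodule k A}
    (h : ∀ a : A, ∀ b ∈ lcs k A n, ⁅a, b⁆ ∈ P) : lcs k A (n + 1) ≤ P := by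
  refine Submodule.span_le.2 ?_
  rintro _ ⟨a, b, hb, rfl⟩
  exact h a b hb

theorem lie_lie_lie_mem_lcs_three (x y z w : A) : ⁅x, ⁅y, ⁅z, w⁆⁆⁆ ∈ lcs k A 3 :=
  lie_mem_lcs_succ k x <| lie_mem_lcs_succ k y <|
    lie_mem_lcs_succ k (n := 0) z Submodule.mem_top

/-- The commutator `[x, e]` as a linear function of `x`. -/
def lieRight (e : A) : A →ₗ[k] A :=
  LinearMap.mulRight k e - LinearMap.mulLeft k e

theorem mul_lie_lie_lie_mem_lcs_three (h3 : (3 : k) ≠ 0) (a b c d e : A) :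
    ⁅a * ⁅b, ⁅c, d⁆⁆, e⁆ ∈ lcs k A 3 := by
  have h := lie_lie_lie_mem_lcs_three k (A := A)
  rw [← Submodule.smul_mem_iff _ h3, ofNat_smul_eq_nsmul, three_nsmul_mul_lie_lie_lie]
  repeat' first | exact h _ _ _ _ | apply add_mem | apply sub_mem | apply nsmul_mem

theorem lie_mul_mem_lcs_three (h3 : (3 : k) ≠ 0) (a e : A) {l : A} (hl : l ∈ lcs k A 2) :
    ⁅a * l, e⁆ ∈ lcs k A 3 := by
  let f : A →ₗ[k] A := lieRight k e ∘ₗ LinearMap.mulLeft k a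
  refine lcs_succ_le_of_lie_mem k (P := (lcs k A 3).comap f) (fun b u hu => ?_) hl
  let g : A →ₗ[k] A := f ∘ₗ (LinearMap.mulLeft k b - LinearMap.mulRight k b)
  refine lcs_succ_le_of_lie_mem k (P := (lcs k A 3).comap g) (fun c d _ => ?_) hu
  exact mul_lie_lie_lie_mem_lcs_three k h3 a b c d e

theorem mul_right_mem_idealGen {S : Set A} {x : A} (c : A) (hx : x ∈ idealGen k S) :
    x * c ∈ idealGen k S := by
  induction hx using Submodule.span_induction with
  | mem x hx =>
    obtain ⟨a, b, s, hs, rfl⟩ := hx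
    exact Submodule.subset_span ⟨a, b * c, s, hs, mul_assoc _ _ _⟩
  | zero => simp
  | add x y _ _ hx hy => rw [add_mul]; exact add_mem hx hy
  | smul r x _ hx => rw [smul_mul_assoc]; exact Submodule.smul_mem _ r hx

theorem subset_idealGen (S : Set A) : S ⊆ idealGen k S :=
  fun s hs => Submodule.subset_span ⟨1, 1, s, hs, by simp⟩

theorem lie_mem_lcs_three_of_mem_Mser_three (h3 : (3 : k) ≠ 0) {m : A} (hm : m ∈ Mser k A 3)
    (e : A) : ⁅m, e⁆ ∈ lcs k A 3 := by
  have hP : Mser k A 3 ≤ (lcs k A 3).comap (lieRight k e) := by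
    refine Submodule.span_le.2 ?_
    rintro _ ⟨a, b, s, hs, rfl⟩
    have hab : a * s * b = a * b * s - a * ⁅b, s⁆ := by
      rw [Ring.lie_def]; noncomm_ring
    rw [hab]
    exact sub_mem (lie_mul_mem_lcs_three k h3 (a * b) e hs)
      (lie_mul_mem_lcs_three k h3 a e (lcs_succ_le k 2 (lie_mem_lcs_succ k b hs)))
  exact hP hm

/-- `[M_3(A), L_2(A)] ⊆ L_5(A)`. -/
theorem lie_mem_lcs_four_of_mem_Mser_three (h3 : (3 : k) ≠ 0) {m : A} (hm : m ∈ Mser k A 3)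
    {u : A} (hu : u ∈ lcs k A 1) : ⁅m, u⁆ ∈ lcs k A 4 := by
  have hP : lcs k A 1 ≤ (lcs k A 4).comap (LinearMap.mulLeft k m - LinearMap.mulRight k m) := by
    refine lcs_succ_le_of_lie_mem k fun x y _ => ?_
    have hL (z : A) := lie_mem_lcs_three_of_mem_Mser_three k h3 hm z
    have h : ⁅m, ⁅x, y⁆⁆ = ⁅x, ⁅m, y⁆⁆ - ⁅y, ⁅m, x⁆⁆ := by
      simp only [Ring.lie_def]; noncomm_ring
    change ⁅m, ⁅x, y⁆⁆ ∈ lcs k A 4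
    rw [h]
    exact sub_mem (lie_mem_lcs_succ k x (hL y)) (lie_mem_lcs_succ k y (hL x))
  exact hP hu

/-- `M_3(A) · L_3(A) ⊆ M_5(A)` over a field of characteristic different from `3`. -/
theorem mul_mem_Mser_five (h3 : (3 : k) ≠ 0) {m s : A} (hm : m ∈ Mser k A 3)
    (hs : s ∈ lcs k A 2) : m * s ∈ Mser k A 5 := by
  refine lcs_succ_le_of_lie_mem k (P := (Mser k A 5).comap (LinearMap.mulLeft k m))
    (fun x u hu => ?_) hs
  have h : m * ⁅x, u⁆ = ⁅m * x, u⁆ - ⁅m, u⁆ * x := by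
    simp only [Ring.lie_def]; noncomm_ring
  have hL {n : A} (hn : n ∈ Mser k A 3) : ⁅n, u⁆ ∈ Mser k A 5 :=
    subset_idealGen k _ (lie_mem_lcs_four_of_mem_Mser_three k h3 hn hu)
  change m * ⁅x, u⁆ ∈ Mser k A 5
  rw [h]
  exact sub_mem (hL (mul_right_mem_idealGen k x hm)) (mul_right_mem_idealGen k x (hL hm))

end LowerCentralSeries

/-- For every associative unital `ℂ`-algebra `A`, one has `M_3(A) · M_3(A) ⊆ M_5(A)`;
that is, the pair (3, 3) is null. -/
theorem Mser_3_mul_Mser_3 (A : Type*) [Ring A] [Algebra ℂ A] :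
    Mser ℂ A 3 * Mser ℂ A 3 ≤ Mser ℂ A 5 := by
  rw [Submodule.mul_le]
  intro m hm n hn
  induction hn using Submodule.span_induction with
  | mem x hx =>
    obtain ⟨a, b, s, hs, rfl⟩ := hx
    have h := mul_mem_Mser_five ℂ three_ne_zero (mul_right_mem_idealGen ℂ a hm) hs
    rw [show m * (a * s * b) = m * a * s * b by simp only [mul_assoc]]
    exact mul_right_mem_idealGen ℂ b h
  | zero => simp
  | add x y _ _ hx hy => rw [mul_add]; exact add_mem hx hy
  | smul c x _ hx => rw [mul_smul_comm]; exact Submodule.smul_mem _ c hx
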